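/- Let A be a unit of ℤ/p^hℤ and set K′ = Σ_{d∈(ℤ/p^hℤ)^×} (d/p)·λ₁(d + A·d⁻¹). If (A/p) = −1 then K′ = 0. If A = u² for a unit u, then K′ = (r/p)·c_p·p^{(h−1)/2}·√p·(λ₁(2u)+λ₁(−2u)) when h is odd, and K′ = (u/p)·p^{h/2}·(λ₁(2u)+(−1/p)·λ₁(−2u)) when h is even. (§4, case (v): evaluation of the Salié-type sum K′.) -/

import Mathlib

noncomputable section
open Matrix Complex

/-- The additive character `x ↦ ζ_N^{r·x} = exp(2πi·r·x/N)` of `ZMod N`. -/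
def aChar (N : ℕ) (r : ℤ) (x : ZMod N) : ℂ :=
  Complex.exp (2 * Real.pi * Complex.I * (r : ℂ) * (x.val : ℂ) / (N : ℂ))

/-- The Legendre symbol `(x/p)` of an element `x : ZMod N` (via its residue mod `p`). -/
def legC (p : ℕ) [Fact p.Prime] {N : ℕ} (x : ZMod N) : ℂ :=
  (legendreSym p (x.val : ℤ) : ℂ)

/-- `c_p = (−1/p)^{1/2}`: `1` if `p ≡ 1 (mod 4)` and `√−1` if `p ≡ 3 (mod 4)`. -/
def cP (p : ℕ) : ℂ := if p % 4 = 1 then 1 else Complex.I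


open Polynomial in
/-- Applying the Euler operator `X * d/dX` repeatedly to `(X - 1) ^ (p - 1) = ∑ X ^ j` in
characteristic `p`. -/
theorem exists_sum_pow_mul_X_pow_eq (p : ℕ) [Fact p.Prime] (i : ℕ) (hi : i ≤ p - 1) :
    ∃ g : (ZMod p)[X],
      ∑ j ∈ Finset.range p, C ((j : ZMod p) ^ i) * X ^ j = (X - 1) ^ (p - 1 - i) * g ∧
        g.eval 1 = (-1) ^ i * (i.factorial : ZMod p) := by
  have hp := (Fact.out : p.Prime)
  induction i with
  | zero =>
    refine ⟨1, ?_, by simp⟩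
    have h1 : (X - 1 : (ZMod p)[X]) ≠ 0 := by
      simpa using X_sub_C_ne_zero (1 : ZMod p)
    apply mul_right_cancel₀ h1
    simp only [pow_zero, map_one, one_mul, mul_one, Nat.sub_zero]
    rw [geom_sum_mul, ← pow_succ, Nat.sub_add_cancel hp.one_le, sub_pow_char, one_pow]
  | succ i ih =>
    obtain ⟨g, hg, hg1⟩ := ih (by omega)
    obtain ⟨k, hk⟩ : ∃ k, p - 1 - i = k + 1 := ⟨p - 1 - i - 1, by omega⟩
    refine ⟨X * (C ((k : ZMod p) + 1) * g + (X - 1) * derivative g), ?_, ?_⟩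
    · have h2 := congrArg (fun f => X * derivative f) hg
      rw [hk] at h2
      simp only [derivative_sum, derivative_mul, derivative_C, Finset.mul_sum,
        derivative_pow, derivative_sub, derivative_X, derivative_one] at h2
      have : p - 1 - (i + 1) = k := by omega
      rw [this]
      refine Eq.trans (Finset.sum_congr rfl fun j _ => ?_) (h2.trans ?_)
      · rcases j with _ | j
        · simp
        · simp only [Nat.add_sub_cancel, map_pow, map_natCast]
          push_cast
          ring
      · simp only [Nat.add_sub_cancel, map_add, map_natCast, map_one]
        push_cast
        ring
    · have hkp : (k : ZMod p) + 1 = -((i : ZMod p) + 1) := by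
        rw [eq_neg_iff_add_eq_zero]
        have : ((k + 1 + (i + 1) : ℕ) : ZMod p) = 0 := by
          rw [show k + 1 + (i + 1) = p by have := hp.two_le; omega]
          simp
        exact_mod_cast this
      rw [hkp]
      simp [hg1, Nat.factorial_succ]
      ring

open Polynomial in
theorem exists_prod_X_pow_sub_X_pow_eq (p m : ℕ) [Fact p.Prime] (hm : m ≤ p) :
    ∃ g : (ZMod p)[X],
      ∏ k ∈ Finset.Ico 1 (m + 1), (X ^ k - X ^ (p - k)) = (X - 1) ^ m * g ∧
        g.eval 1 = 2 ^ m * (m.factorial : ZMod p) := by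
  induction m with
  | zero => exact ⟨1, by simp⟩
  | succ m ih =>
    obtain ⟨g, hg, hg1⟩ := ih (by omega)
    refine ⟨g * (∑ j ∈ Finset.range (m + 1), X ^ j - ∑ j ∈ Finset.range (p - (m + 1)), X ^ j),
      ?_, ?_⟩
    · rw [Finset.prod_Ico_succ_top (by omega), hg]
      have h1 := geom_sum_mul (X : (ZMod p)[X]) (m + 1)
      have h2 := geom_sum_mul (X : (ZMod p)[X]) (p - (m + 1))
      linear_combination (-(X - 1) ^ m * g) * h1 + ((X - 1) ^ m * g) * h2
    · have : ((p - (m + 1) : ℕ) : ZMod p) = -((m : ZMod p) + 1) := by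
        rw [Nat.cast_sub hm]; simp
      simp only [eval_mul, eval_sub, eval_finsetSum, eval_pow, eval_X, one_pow, hg1]
      simp [this, Nat.factorial_succ]
      ring

open Polynomial in
/-- If the quadratic Gauss sum is `ε` times Kronecker's product, then `ε = (-2/p)`. -/
theorem sign_eq_legendreSym_neg_two (p : ℕ) [Fact p.Prime] (hp : p ≠ 2) {ζ : ℂ}
    (hζ : IsPrimitiveRoot ζ p) (ε : ℤ) (hε : ε = 1 ∨ ε = -1)
    (h : ∑ j ∈ Finset.range p, (legendreSym p j : ℂ) * ζ ^ j =
      ε * ∏ k ∈ Finset.Ico 1 (p / 2 + 1), (ζ ^ k - ζ ^ (p - k))) :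
    ε = legendreSym p (-2) := by
  have hpp := (Fact.out : p.Prime)
  have hodd := hpp.mod_two_eq_one_iff_ne_two.2 hp
  set m := p / 2 with hm
  set F : ℤ[X] := ∑ j ∈ Finset.range p, C (legendreSym p j) * X ^ j -
    C ε * ∏ k ∈ Finset.Ico 1 (m + 1), (X ^ k - X ^ (p - k)) with hF
  have hF0 : aeval ζ F = 0 := by
    simp [hF, map_prod, h]
  have hdvd : cyclotomic p ℤ ∣ F := by
    rw [cyclotomic_eq_minpoly hζ hpp.pos]
    exact minpoly.isIntegrallyClosed_dvd (hζ.isIntegral hpp.pos) hF0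
  have hdvd2 := map_dvd (mapRingHom (Int.castRingHom (ZMod p))) hdvd
  have h1 : (X - 1 : (ZMod p)[X]) ≠ 0 := by
    simpa using X_sub_C_ne_zero (1 : ZMod p)
  have hcyc : cyclotomic p (ZMod p) = (X - 1) ^ (p - 1) := by
    apply mul_right_cancel₀ h1
    rw [cyclotomic_prime, geom_sum_mul, ← pow_succ, Nat.sub_add_cancel hpp.one_le, sub_pow_char,
      one_pow]
  obtain ⟨g, hg, hg1⟩ := exists_sum_pow_mul_X_pow_eq p m (by omega)
  obtain ⟨k, hk, hk1⟩ := exists_prod_X_pow_sub_X_pow_eq p m (by omega)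
  rw [show p - 1 - m = m by omega] at hg
  have hmap : mapRingHom (Int.castRingHom (ZMod p)) F =
      (X - 1) ^ m * (g - C (ε : ZMod p) * k) := by
    rw [mul_sub, ← hg, mul_left_comm, ← hk]
    have hl (j : ℕ) : ((legendreSym p j : ℤ) : (ZMod p)[X]) = (j : (ZMod p)[X]) ^ m := by
      simpa using congrArg C (legendreSym.eq_pow p j)
    simp [hF, Polynomial.map_sum, Polynomial.map_prod, hl]
  rw [hmap, coe_mapRingHom, map_cyclotomic, hcyc, show p - 1 = m + m by omega, pow_add] at hdvd2
  have h3 := (mul_dvd_mul_iff_left (pow_ne_zero m h1)).1 hdvd2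
  have h4 : eval 1 (g - C (ε : ZMod p) * k) = 0 := by
    obtain ⟨q, hq⟩ := h3
    have : m ≠ 0 := by have := hpp.two_le; omega
    rw [hq]
    simp [this]
  have hfac : (m.factorial : ZMod p) ≠ 0 := by
    rw [Ne, ZMod.natCast_eq_zero_iff, hpp.dvd_factorial]
    have := hpp.two_le; omega
  have h5 : (-1 : ZMod p) ^ m = ε * 2 ^ m := by
    apply mul_right_cancel₀ hfac
    simp only [eval_sub, eval_mul, eval_C, hg1, hk1] at h4
    linear_combination h4
  have h6 : (ε : ZMod p) = (legendreSym p (-2) : ℤ) := by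
    rw [legendreSym.eq_pow, ← hm]
    push_cast
    have hε2 : (ε : ZMod p) * ε = 1 := by rcases hε with rfl | rfl <;> simp
    have : (-1 : ZMod p) ^ m * (-1) ^ m = 1 := by rw [← mul_pow]; simp
    rw [neg_pow]
    linear_combination (-(ε : ZMod p)) * this + (ε : ZMod p) * (-1) ^ m * h5 +
      ((-1) ^ m * 2 ^ m) * hε2
  have hne : (((-2 : ℤ)) : ZMod p) ≠ 0 := by
    have : ((2 : ℕ) : ZMod p) ≠ 0 := by
      rw [Ne, ZMod.natCast_eq_zero_iff]
      intro h
      exact hp ((Nat.prime_dvd_prime_iff_eq hpp Nat.prime_two).1 h)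
    push_cast at this ⊢
    simpa using this
  have : Fact (2 < p) := ⟨by have := hpp.two_le; omega⟩
  have h11 : (-1 : ZMod p) ≠ 1 := ZMod.neg_one_ne_one
  rcases hε with rfl | rfl <;> rcases legendreSym.eq_one_or_neg_one p hne with h | h <;>
    rw [h] at h6 ⊢
  · exact absurd (by simpa using h6.symm) h11
  · exact absurd (by simpa using h6) h11

/-- The square of Kronecker's product `∏ (ζ ^ k - ζ ^ (-k))`, `1 ≤ k ≤ (p - 1) / 2`. -/
theorem prod_pow_sub_pow_sq {p : ℕ} (hp : p % 2 = 1) {ζ : ℂ} (hζ : IsPrimitiveRoot ζ p) :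
    (∏ k ∈ Finset.Ico 1 (p / 2 + 1), (ζ ^ k - ζ ^ (p - k))) ^ 2 = (-1) ^ (p / 2) * p := by
  have hζ2 : IsPrimitiveRoot (ζ ^ 2) p :=
    hζ.pow_of_coprime 2 ((Nat.coprime_two_left).2 (Nat.odd_iff.2 hp))
  obtain ⟨m, rfl⟩ : ∃ m, p = 2 * m + 1 := ⟨p / 2, by omega⟩
  have h1 := hζ2.prod_one_sub_pow_eq_order
  have h2 := Finset.prod_Ico_reflect (fun k => 1 - (ζ ^ 2) ^ k) 1 (m := m + 1) (n := 2 * m + 1)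
    (by omega)
  rw [Finset.range_eq_Ico, Finset.prod_Ico_add' (fun k => 1 - (ζ ^ 2) ^ k) 0 (2 * m) 1, zero_add,
    ← Finset.prod_Ico_consecutive _ (show 1 ≤ m + 1 by omega) (show m + 1 ≤ 2 * m + 1 by omega),
    show Finset.Ico (m + 1) (2 * m + 1) = Finset.Ico (2 * m + 1 + 1 - (m + 1)) (2 * m + 1 + 1 - 1)
      by congr 1; omega, ← h2, ← Finset.prod_mul_distrib] at h1
  rw [show (2 * m + 1) / 2 = m by omega]
  push_cast at h1 ⊢
  rw [← h1, ← Finset.prod_pow]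
  have h3 : ((-1 : ℂ)) ^ m = ∏ k ∈ Finset.Ico 1 (m + 1), (-1) := by simp
  rw [h3, ← Finset.prod_mul_distrib]
  refine Finset.prod_congr rfl fun k hk => ?_
  have h4 : ζ ^ k * ζ ^ (2 * m + 1 - k) = 1 := by
    rw [← pow_add, Nat.add_sub_cancel' (by simp at hk; omega), hζ.pow_eq_one]
  rw [pow_right_comm ζ 2 k, pow_right_comm ζ 2]
  generalize ζ ^ (2 * m + 1 - k) = b at h4 ⊢
  linear_combination (ζ ^ k * b - 1) * h4

theorem prod_exp_sub_exp_eq_prod_sin {p : ℕ} (hp : p ≠ 0) :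
    ∏ k ∈ Finset.Ico 1 (p / 2 + 1), (exp (2 * Real.pi * I / p) ^ k -
      exp (2 * Real.pi * I / p) ^ (p - k)) =
    I ^ (p / 2) *
      ((∏ k ∈ Finset.Ico 1 (p / 2 + 1), 2 * Real.sin (2 * Real.pi * k / p) : ℝ) : ℂ) := by
  have h3 : I ^ (p / 2) = ∏ k ∈ Finset.Ico 1 (p / 2 + 1), I := by simp
  rw [h3]
  push_cast
  rw [← Finset.prod_mul_distrib]
  refine Finset.prod_congr rfl fun k hk => ?_
  have hk' : k ≤ p := by simp at hk; omega
  have hp' : (p : ℂ) ≠ 0 := by exact_mod_cast hp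
  have h1 : exp (2 * Real.pi * I / p) ^ k = exp (2 * Real.pi * k / p * I) := by
    rw [← exp_nat_mul]; congr 1; ring
  have h2 : exp (2 * Real.pi * I / p) ^ (p - k) = exp (-(2 * Real.pi * k / p) * I) := by
    rw [← exp_nat_mul, Nat.cast_sub hk', ← exp_periodic (-(2 * Real.pi * k / p) * I)]
    congr 1; field_simp; ring
  rw [h1, h2, exp_mul_I, exp_mul_I, Complex.cos_neg, Complex.sin_neg]
  ring

theorem prod_two_mul_sin_pos {p : ℕ} (hp : p % 2 = 1) :
    0 < ∏ k ∈ Finset.Ico 1 (p / 2 + 1), 2 * Real.sin (2 * Real.pi * k / p) := by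
  refine Finset.prod_pos fun k hk => mul_pos two_pos ?_
  simp only [Finset.mem_Ico] at hk
  have hp0 : (0 : ℝ) < p := by exact_mod_cast (by omega : 0 < p)
  have hk0 : (0 : ℝ) < k := by exact_mod_cast (by omega : 0 < k)
  have hkp : (2 * k : ℝ) < p := by exact_mod_cast (by omega : 2 * k < p)
  apply Real.sin_pos_of_pos_of_lt_pi
  · have := Real.pi_pos; positivity
  · rw [div_lt_iff₀ hp0]
    nlinarith [Real.pi_pos]

theorem legendreSym_neg_two_mul_I_pow (p : ℕ) [Fact p.Prime] (hp : p ≠ 2) :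
    (legendreSym p (-2) : ℂ) * I ^ (p / 2) = cP p := by
  have hodd := (Fact.out : p.Prime).mod_two_eq_one_iff_ne_two.2 hp
  have h8 : p % 8 = 1 ∨ p % 8 = 3 ∨ p % 8 = 5 ∨ p % 8 = 7 := by omega
  rw [legendreSym.at_neg_two hp, cP]
  have hI : I ^ 4 = 1 := I_pow_four
  have hm : p / 2 = 4 * (p / 8) + (p % 8) / 2 := by omega
  have h4 : p % 4 = (p % 8) % 4 := by omega
  rw [hm, pow_add, pow_mul, hI, one_pow, one_mul, h4, ← ZMod.natCast_mod p 8]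
  rcases h8 with h | h | h | h <;> rw [h] <;> simp [I_pow_three]

/-- The quadratic character of `ZMod p` with complex values. -/
def quadCharC (p : ℕ) [Fact p.Prime] : MulChar (ZMod p) ℂ :=
  (quadraticChar (ZMod p)).ringHomComp (Int.castRingHom ℂ)

theorem quadCharC_intCast (p : ℕ) [Fact p.Prime] (a : ℤ) :
    quadCharC p (a : ZMod p) = legendreSym p a := rfl

theorem sum_zmod_eq_sum_range {M : Type*} [AddCommMonoid M] (n : ℕ) [NeZero n] (f : ZMod n → M) :
    ∑ x : ZMod n, f x = ∑ j ∈ Finset.range n, f j := by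
  refine Finset.sum_nbij' ZMod.val (fun j => (j : ZMod n)) ?_ ?_ ?_ ?_ ?_
  · intro x _; simp [ZMod.val_lt]
  · simp
  · intro x _; simp
  · intro j hj; simp at hj; simp [ZMod.val_natCast, Nat.mod_eq_of_lt hj]
  · intro x _; simp

/-- Gauss's evaluation of the quadratic Gauss sum, including its sign. -/
theorem gaussSum_quadCharC (p : ℕ) [Fact p.Prime] (hp : p ≠ 2) :
    gaussSum (quadCharC p) (ZMod.stdAddChar (N := p)) = cP p * (Real.sqrt p : ℂ) := by
  have hpp := (Fact.out : p.Prime)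
  have hodd := hpp.mod_two_eq_one_iff_ne_two.2 hp
  have hring : ringChar (ZMod p) ≠ 2 := by rwa [ZMod.ringChar_zmod_n]
  set G := gaussSum (quadCharC p) (ZMod.stdAddChar (N := p)) with hG
  set ζ := exp (2 * Real.pi * I / p) with hζdef
  have hζ : IsPrimitiveRoot ζ p := isPrimitiveRoot_exp p hpp.ne_zero
  set P := ∏ k ∈ Finset.Ico 1 (p / 2 + 1), (ζ ^ k - ζ ^ (p - k)) with hP
  set R := ∏ k ∈ Finset.Ico 1 (p / 2 + 1), 2 * Real.sin (2 * Real.pi * k / p) with hR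
  have hPR : P = I ^ (p / 2) * (R : ℂ) := prod_exp_sub_exp_eq_prod_sin hpp.ne_zero
  have hP2 : P ^ 2 = (-1) ^ (p / 2) * p := prod_pow_sub_pow_sq hodd hζ
  have hsum : ∑ j ∈ Finset.range p, (legendreSym p j : ℂ) * ζ ^ j = G := by
    rw [hG, gaussSum, sum_zmod_eq_sum_range]
    refine Finset.sum_congr rfl fun j _ => ?_
    have h1 := quadCharC_intCast p j
    have h2 := ZMod.stdAddChar_coe (N := p) j
    push_cast at h1 h2
    rw [h1, h2, hζdef, ← exp_nat_mul]
    congr 2; ring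
  have hG2 : G ^ 2 = (-1) ^ (p / 2) * p := by
    rw [hG, gaussSum_sq _ _ (ZMod.isPrimitive_stdAddChar p)]
    · have := quadCharC_intCast p (-1)
      push_cast at this
      rw [this, legendreSym.at_neg_one hp, ZMod.χ₄_eq_neg_one_pow hodd, ZMod.card]
      push_cast; rfl
    · exact fun h => quadraticChar_ne_one hring
        ((MulChar.ringHomComp_eq_one_iff Int.cast_injective).1 h)
    · exact (quadraticChar_isQuadratic _).comp _
  obtain ⟨ε, hε, hGP⟩ : ∃ ε : ℤ, (ε = 1 ∨ ε = -1) ∧ G = ε * P := by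
    rcases sq_eq_sq_iff_eq_or_eq_neg.1 (hG2.trans hP2.symm) with h | h
    · exact ⟨1, Or.inl rfl, by simpa using h⟩
    · exact ⟨-1, Or.inr rfl, by simpa using h⟩
  have hε2 := sign_eq_legendreSym_neg_two p hp hζ ε hε (hsum.trans hGP)
  have hR2 : R ^ 2 = p := by
    rw [hPR, mul_pow, ← pow_mul, mul_comm (p / 2), pow_mul, I_sq] at hP2
    have := mul_left_cancel₀ (pow_ne_zero _ (by norm_num)) hP2
    exact_mod_cast this
  have hRs : Real.sqrt p = R := by
    rw [← hR2, Real.sqrt_sq (prod_two_mul_sin_pos hodd).le]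
  rw [hGP, hε2, hPR, hRs, ← legendreSym_neg_two_mul_I_pow p hp]
  ring

/-- The sum of the quadratic character over the solutions of `e + e⁻¹ = t`. -/
theorem sum_quadraticChar_filter_add_inv_eq {F : Type*} [Field F] [Fintype F] [DecidableEq F]
    (hF : ringChar F ≠ 2) (t : F) :
    ∑ e : F with e ^ 2 - t * e + 1 = 0, quadraticChar F e =
      quadraticChar F (t + 2) + quadraticChar F (t - 2) := by
  have h2 : (2 : F) ≠ 0 := Ring.two_ne_zero hF
  by_cases ht : t = -2
  · subst ht
    have : (Finset.univ.filter fun e : F => e ^ 2 - -2 * e + 1 = 0) = {-1} := by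
      ext e
      simp only [Finset.mem_filter, Finset.mem_univ, true_and, Finset.mem_singleton]
      rw [show e ^ 2 - -2 * e + 1 = (e + 1) ^ 2 by ring, sq_eq_zero_iff, add_eq_zero_iff_eq_neg]
    rw [this, Finset.sum_singleton, show (-2 - 2 : F) = (-1) * 2 ^ 2 by ring, map_mul,
      quadraticChar_sq_one' h2]
    simp
  · have ht2 : t + 2 ≠ 0 := fun h => ht (eq_neg_of_add_eq_zero_left h)
    have hsq := quadraticChar_sq_one ht2
    have h1 : ∀ e ∈ Finset.univ.filter (fun e : F => e ^ 2 - t * e + 1 = 0),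
        quadraticChar F e = quadraticChar F (t + 2) := by
      intro e he
      simp only [Finset.mem_filter, Finset.mem_univ, true_and] at he
      have he1 : e * (t + 2) = (e + 1) ^ 2 := by linear_combination -he
      have he0 : e ≠ 0 := by rintro rfl; simp at he
      have he2 : e + 1 ≠ 0 := by
        intro h
        rw [h] at he1
        simp [he0, ht2] at he1
      have h3 := quadraticChar_sq_one' he2
      rw [← he1, map_mul] at h3
      linear_combination quadraticChar F (t + 2) * h3 - quadraticChar F e * hsq
    rw [Finset.sum_congr rfl h1, Finset.sum_const, nsmul_eq_mul]
    have hcard : ((Finset.univ.filter fun e : F => e ^ 2 - t * e + 1 = 0).card : ℤ) =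
        quadraticChar F (t ^ 2 - 4) + 1 := by
      rw [← quadraticChar_card_sqrts hF]
      congr 1
      refine Finset.card_nbij' (fun e => 2 * e - t) (fun s => (s + t) / 2) ?_ ?_ ?_ ?_
      · intro e he
        simp only [Finset.coe_filter, Finset.mem_univ, true_and, Set.mem_ofPred_eq,
          Set.coe_toFinset] at he ⊢
        linear_combination 4 * he
      · intro s hs
        simp only [Finset.coe_filter, Finset.mem_univ, true_and, Set.mem_ofPred_eq,
          Set.coe_toFinset] at hs ⊢
        field_simp
        linear_combination hs
      · intro e _; field_simp; ring
      · intro s _; field_simp; ring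
    rw [hcard, show t ^ 2 - 4 = (t + 2) * (t - 2) by ring, map_mul]
    linear_combination quadraticChar F (t - 2) * hsq

/-- The Salié sum over a finite prime field. -/
theorem sum_units_quadCharC_mul_addChar (p : ℕ) [Fact p.Prime] (hp : p ≠ 2)
    (ψ : AddChar (ZMod p) ℂ) :
    ∑ d : (ZMod p)ˣ, quadCharC p d * ψ (d + (d⁻¹ : (ZMod p)ˣ)) =
      gaussSum (quadCharC p) ψ * (ψ 2 + ψ (-2)) := by
  have hring : ringChar (ZMod p) ≠ 2 := by rwa [ZMod.ringChar_zmod_n]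
  have h1 (t : ZMod p) : ∑ e : ZMod p with e ^ 2 - t * e + 1 = 0, quadCharC p e =
      quadCharC p (t + 2) + quadCharC p (t - 2) := by
    have := congrArg (fun z : ℤ => (z : ℂ)) (sum_quadraticChar_filter_add_inv_eq hring t)
    push_cast at this
    exact this
  have h2 : ∑ d : (ZMod p)ˣ, quadCharC p d * ψ (d + (d⁻¹ : (ZMod p)ˣ)) =
      ∑ e : ZMod p, quadCharC p e * ψ (e + e⁻¹) := by
    refine Fintype.sum_of_injective (fun d : (ZMod p)ˣ => (d : ZMod p))
      Units.val_injective _ _ ?_ ?_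
    · intro e he
      have : ¬IsUnit e := fun h => he ⟨h.unit, h.unit_spec⟩
      rw [MulChar.map_nonunit _ this, zero_mul]
    · intro d; rw [Units.val_inv_eq_inv_val]
  have h3 (e : ZMod p) : quadCharC p e * ψ (e + e⁻¹) =
      ∑ t : ZMod p, if e ^ 2 - t * e + 1 = 0 then quadCharC p e * ψ t else 0 := by
    by_cases he : e = 0
    · simp [he, MulChar.map_zero (quadCharC p)]
    · have (t : ZMod p) : e ^ 2 - t * e + 1 = 0 ↔ t = e + e⁻¹ := by
        constructor
        · intro h
          field_simp
          linear_combination -h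
        · rintro rfl
          field_simp
          ring
      simp [this]
  rw [h2, Finset.sum_congr rfl fun e _ => h3 e, Finset.sum_comm]
  simp_rw [← Finset.sum_filter, ← Finset.sum_mul, h1, add_mul]
  rw [Finset.sum_add_distrib, mul_add, gaussSum, Finset.sum_mul, Finset.sum_mul, add_comm]
  congr 1
  · refine Fintype.sum_equiv (Equiv.subRight 2) _ _ fun t => ?_
    simp [mul_assoc, ← AddChar.map_add_eq_mul]
  · refine Fintype.sum_equiv (Equiv.addRight 2) _ _ fun t => ?_
    simp [mul_assoc, ← AddChar.map_add_eq_mul]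

theorem sum_addChar_sq (p : ℕ) [Fact p.Prime] (hp : p ≠ 2) {ψ : AddChar (ZMod p) ℂ}
    (hψ : ψ ≠ 1) :
    ∑ z : ZMod p, ψ (z ^ 2) = gaussSum (quadCharC p) ψ := by
  have hring : ringChar (ZMod p) ≠ 2 := by rwa [ZMod.ringChar_zmod_n]
  have h1 (t : ZMod p) : ∑ z : ZMod p with z ^ 2 = t, ψ (z ^ 2) = (quadCharC p t + 1) * ψ t := by
    have h := congrArg (fun z : ℤ => (z : ℂ)) (quadraticChar_card_sqrts hring t)
    push_cast at h
    rw [Finset.sum_congr rfl (g := fun _ => ψ t)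
      (by intro z hz; rw [(Finset.mem_filter.1 hz).2]), Finset.sum_const, nsmul_eq_mul]
    congr 1
    refine Eq.trans ?_ h
    congr 2
    ext; simp
  rw [← Finset.sum_fiberwise Finset.univ (fun z : ZMod p => z ^ 2)]
  simp_rw [h1, add_mul, one_mul]
  rw [Finset.sum_add_distrib, AddChar.sum_eq_zero_of_ne_one hψ, add_zero, gaussSum]

theorem gaussSum_quadCharC_mulShift (p : ℕ) [Fact p.Prime] (hp : p ≠ 2) (a : (ZMod p)ˣ) :
    gaussSum (quadCharC p) (AddChar.mulShift (ZMod.stdAddChar (N := p)) a) =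
      quadCharC p a * (cP p * (Real.sqrt p : ℂ)) := by
  have hq : (quadCharC p).IsQuadratic := (quadraticChar_isQuadratic _).comp _
  rw [gaussSum_mulShift_eq, gaussSum_quadCharC p hp, hq.inv]

/-- Only the terms near the critical points of `d + d⁻¹` contribute to the Salié sum. -/
theorem sum_units_eq_sum_filter (p h n : ℕ) [Fact p.Prime] (hn : n ≠ 0) (hnh : h ≤ 2 * n)
    (hdvd : p ∣ p ^ h) (a : (ZMod (p ^ h))ˣ) :
    ∑ d : (ZMod (p ^ h))ˣ, quadCharC p (ZMod.castHom hdvd (ZMod p) d) *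
        ZMod.stdAddChar (a * (d + (d⁻¹ : (ZMod (p ^ h))ˣ)) : ZMod (p ^ h)) =
      ∑ d : (ZMod (p ^ h))ˣ with (p : ZMod (p ^ h)) ^ n * (d - (d⁻¹ : (ZMod (p ^ h))ˣ)) = 0,
        quadCharC p (ZMod.castHom hdvd (ZMod p) d) *
          ZMod.stdAddChar (a * (d + (d⁻¹ : (ZMod (p ^ h))ˣ)) : ZMod (p ^ h)) := by
  have hN : ((Fintype.card (ZMod (p ^ h)) : ℕ) : ℂ) ≠ 0 := by
    rw [ZMod.card]; simp [(Fact.out : p.Prime).ne_zero]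
  have hp2 : (p : ZMod (p ^ h)) ^ n * (p : ZMod (p ^ h)) ^ n = 0 := by
    rw [← pow_add, ← Nat.cast_pow, ZMod.natCast_eq_zero_iff]
    exact pow_dvd_pow p (by omega)
  set f : (ZMod (p ^ h))ˣ → ℂ := fun d => quadCharC p (ZMod.castHom hdvd (ZMod p) d) *
    ZMod.stdAddChar (a * (d + (d⁻¹ : (ZMod (p ^ h))ˣ)) : ZMod (p ^ h)) with hf
  have hshift (y : ZMod (p ^ h)) : ∑ d, f d = ∑ d : (ZMod (p ^ h))ˣ, f d * ZMod.stdAddChar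
      (y * (a * (p ^ n * (d - (d⁻¹ : (ZMod (p ^ h))ˣ)))) : ZMod (p ^ h)) := by
    let w : (ZMod (p ^ h))ˣ :=
      ⟨1 + p ^ n * y, 1 - p ^ n * y, by linear_combination (-y ^ 2) * hp2,
        by linear_combination (-y ^ 2) * hp2⟩
    rw [← Equiv.sum_comp (Equiv.mulRight w)]
    refine Finset.sum_congr rfl fun d _ => ?_
    have hw : ZMod.castHom hdvd (ZMod p) (w : ZMod (p ^ h)) = 1 := by
      change ZMod.castHom hdvd (ZMod p) (1 + p ^ n * y) = 1
      rw [map_add, map_mul, map_pow, map_natCast, map_one]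
      simp [hn]
    have hwi : ((w⁻¹ : (ZMod (p ^ h))ˣ) : ZMod (p ^ h)) = 1 - p ^ n * y := rfl
    have hwv : (w : ZMod (p ^ h)) = 1 + p ^ n * y := rfl
    simp only [hf, Equiv.coe_mulRight, _root_.mul_inv_rev, Units.val_mul,
      map_mul (ZMod.castHom hdvd _), hw, mul_one]
    rw [mul_assoc, ← AddChar.map_add_eq_mul, hwi, hwv]
    congr 2
    ring
  apply mul_left_cancel₀ hN
  calc _ = ∑ y : ZMod (p ^ h), ∑ d, f d := by simp
    _ = ∑ d, f d * ∑ y : ZMod (p ^ h), ZMod.stdAddChar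
        (y * (a * (p ^ n * (d - (d⁻¹ : (ZMod (p ^ h))ˣ)))) : ZMod (p ^ h)) := by
      rw [Finset.sum_congr rfl fun y _ => hshift y, Finset.sum_comm]
      simp_rw [Finset.mul_sum]
    _ = _ := by
      rw [Finset.sum_filter, Finset.mul_sum]
      refine Finset.sum_congr rfl fun d _ => ?_
      rw [AddChar.sum_mulShift _ (ZMod.isPrimitive_stdAddChar _)]
      simp only [Units.mul_right_eq_zero]
      split_ifs <;> simp only [hf, mul_zero, zero_mul, mul_comm, Nat.cast_zero]

theorem quadCharC_neg_one (p : ℕ) [Fact p.Prime] : quadCharC p (-1) = legendreSym p (-1) := by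
  simpa using quadCharC_intCast p (-1)

theorem zmod_isUnit_of_castHom_ne_zero {p h : ℕ} [Fact p.Prime] (hdvd : p ∣ p ^ h)
    {x : ZMod (p ^ h)} (hx : ZMod.castHom hdvd (ZMod p) x ≠ 0) : IsUnit x := by
  obtain ⟨k, rfl⟩ := ZMod.natCast_zmod_surjective x
  rw [map_natCast, Ne, ZMod.natCast_eq_zero_iff] at hx
  rw [ZMod.isUnit_iff_coprime]
  exact (((Nat.Prime.coprime_iff_not_dvd Fact.out).2 hx).symm).pow_right h

theorem castHom_eq_zero_of_pow_mul_eq_zero {p h n : ℕ} [Fact p.Prime] (hn : n < h)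
    (hdvd : p ∣ p ^ h) {x : ZMod (p ^ h)} (hx : (p : ZMod (p ^ h)) ^ n * x = 0) :
    ZMod.castHom hdvd (ZMod p) x = 0 := by
  by_contra hne
  rw [(zmod_isUnit_of_castHom_ne_zero hdvd hne).mul_left_eq_zero, ← Nat.cast_pow,
    ZMod.natCast_eq_zero_iff, Nat.pow_dvd_pow_iff_le_right (Fact.out : p.Prime).one_lt] at hx
  omega

/-- The critical points of `d + d⁻¹` are `±1`, so the Salié sum is a sum over two neighbourhoods. -/
theorem sum_units_eq_local_add_local (p h n : ℕ) [Fact p.Prime] (hp : p ≠ 2) (hn : n ≠ 0)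
    (hnh : h ≤ 2 * n) (hnlt : n < h) (hdvd : p ∣ p ^ h) (a : (ZMod (p ^ h))ˣ) :
    ∑ d : (ZMod (p ^ h))ˣ, quadCharC p (ZMod.castHom hdvd (ZMod p) d) *
        ZMod.stdAddChar (a * (d + (d⁻¹ : (ZMod (p ^ h))ˣ)) : ZMod (p ^ h)) =
      (∑ d : (ZMod (p ^ h))ˣ with (p : ZMod (p ^ h)) ^ n * (Units.val d - 1) = 0,
        ZMod.stdAddChar (a * (d + (d⁻¹ : (ZMod (p ^ h))ˣ)) : ZMod (p ^ h))) +
      quadCharC p (-1) * ∑ d : (ZMod (p ^ h))ˣ with (p : ZMod (p ^ h)) ^ n * (Units.val d - 1) = 0,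
        ZMod.stdAddChar ((-a : (ZMod (p ^ h))ˣ) *
          (d + (d⁻¹ : (ZMod (p ^ h))ˣ)) : ZMod (p ^ h)) := by
  have h2 : (2 : ZMod p) ≠ 0 := Ring.two_ne_zero (by rwa [ZMod.ringChar_zmod_n])
  have hcast {d : (ZMod (p ^ h))ˣ} (hd : (p : ZMod (p ^ h)) ^ n * (d - 1) = 0) :
      ZMod.castHom hdvd (ZMod p) d = 1 := by
    have := castHom_eq_zero_of_pow_mul_eq_zero hnlt hdvd hd
    rwa [map_sub, map_one, sub_eq_zero] at this
  have hcast' {d : (ZMod (p ^ h))ˣ} (hd : (p : ZMod (p ^ h)) ^ n * (d + 1) = 0) :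
      ZMod.castHom hdvd (ZMod p) d = -1 := by
    have := castHom_eq_zero_of_pow_mul_eq_zero hnlt hdvd hd
    rwa [map_add, map_one, add_eq_zero_iff_eq_neg] at this
  have hiff (d : (ZMod (p ^ h))ˣ) :
      (p : ZMod (p ^ h)) ^ n * (d - (d⁻¹ : (ZMod (p ^ h))ˣ)) = 0 ↔
        (p : ZMod (p ^ h)) ^ n * (d - 1) = 0 ∨ (p : ZMod (p ^ h)) ^ n * (d + 1) = 0 := by
    have hd : (d : ZMod (p ^ h)) * (d⁻¹ : (ZMod (p ^ h))ˣ) = 1 := d.mul_inv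
    have h1 : (p : ZMod (p ^ h)) ^ n * (d - (d⁻¹ : (ZMod (p ^ h))ˣ)) = 0 ↔
        (p : ZMod (p ^ h)) ^ n * (d - 1) * (d + 1) = 0 := by
      rw [← Units.mul_left_eq_zero d]
      exact Eq.congr (by linear_combination (-(p : ZMod (p ^ h)) ^ n) * hd) rfl
    rw [h1]
    constructor
    · intro h0
      by_cases h3 : ZMod.castHom hdvd (ZMod p) ((d : ZMod (p ^ h)) + 1) = 0
      · right
        have : IsUnit ((d : ZMod (p ^ h)) - 1) := by
          apply zmod_isUnit_of_castHom_ne_zero hdvd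
          intro h4
          rw [map_add, map_one] at h3
          rw [map_sub, map_one] at h4
          exact h2 (by linear_combination h3 - h4)
        rwa [mul_right_comm, this.mul_left_eq_zero] at h0
      · left
        rwa [(zmod_isUnit_of_castHom_ne_zero hdvd h3).mul_left_eq_zero] at h0
    · rintro (h0 | h0)
      · rw [h0, zero_mul]
      · rw [mul_right_comm, h0, zero_mul]
  rw [sum_units_eq_sum_filter p h n hn hnh hdvd a, Finset.filter_congr fun d _ => hiff d,
    Finset.filter_or, Finset.sum_union]
  · congr 1
    · refine Finset.sum_congr rfl fun d hd => ?_
      rw [hcast (Finset.mem_filter.1 hd).2, map_one, one_mul]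
    · rw [Finset.mul_sum]
      refine Finset.sum_nbij' (fun d => -d) (fun d => -d) ?_ ?_ ?_ ?_ ?_
      · intro d hd
        simp only [Finset.mem_filter, Finset.mem_univ, true_and, Units.val_neg] at hd ⊢
        linear_combination -hd
      · intro d hd
        simp only [Finset.mem_filter, Finset.mem_univ, true_and, Units.val_neg] at hd ⊢
        linear_combination -hd
      · simp
      · simp
      · intro d hd
        rw [hcast' (Finset.mem_filter.1 hd).2]
        congr 2
        simp only [inv_neg, Units.val_neg]
        ring
  · rw [Finset.disjoint_filter]
    intro d _ hd hd'
    have := hcast hd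
    rw [hcast' hd'] at this
    exact h2 (by linear_combination -this)

theorem sum_local_eq_sum_range (p h n m : ℕ) [Fact p.Prime] (hh : h = n + m) (hnm : n ≤ 2 * m)
    (a : ZMod (p ^ h)) :
    ∑ d : (ZMod (p ^ h))ˣ with (p : ZMod (p ^ h)) ^ n * (Units.val d - 1) = 0,
        ZMod.stdAddChar (a * (d + (d⁻¹ : (ZMod (p ^ h))ˣ)) : ZMod (p ^ h)) =
      ZMod.stdAddChar (2 * a : ZMod (p ^ h)) *
        ∑ z ∈ Finset.range (p ^ n),
          ZMod.stdAddChar ((p : ZMod (p ^ h)) ^ (2 * m) * (a * (z : ZMod (p ^ h)) ^ 2)) := by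
  have hpp := (Fact.out : p.Prime)
  have hp3 : (p : ZMod (p ^ h)) ^ m * (p : ZMod (p ^ h)) ^ m * (p : ZMod (p ^ h)) ^ m = 0 := by
    rw [← pow_add, ← pow_add, ← Nat.cast_pow, ZMod.natCast_eq_zero_iff]
    exact pow_dvd_pow p (by omega)
  have hpnm : (p : ZMod (p ^ h)) ^ n * (p : ZMod (p ^ h)) ^ m = 0 := by
    rw [← pow_add, ← Nat.cast_pow, ZMod.natCast_eq_zero_iff, hh]
  let w (z : ℕ) : (ZMod (p ^ h))ˣ :=
    ⟨1 + p ^ m * z, 1 - p ^ m * z + p ^ m * p ^ m * z ^ 2,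
      by linear_combination (z : ZMod (p ^ h)) ^ 3 * hp3,
      by linear_combination (z : ZMod (p ^ h)) ^ 3 * hp3⟩
  have hwi (z : ℕ) : (((w z)⁻¹ : (ZMod (p ^ h))ˣ) : ZMod (p ^ h)) =
    1 - p ^ m * z + p ^ m * p ^ m * z ^ 2 := rfl
  have hwv (z : ℕ) : (w z : ZMod (p ^ h)) = 1 + p ^ m * z := rfl
  rw [Finset.mul_sum]
  symm
  refine Finset.sum_bij (fun z _ => w z) ?_ ?_ ?_ ?_
  · intro z _
    rw [Finset.mem_filter, hwv]
    exact ⟨Finset.mem_univ _, by linear_combination (z : ZMod (p ^ h)) * hpnm⟩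
  · intro z hz z' hz' hw
    have h1 := congrArg Units.val hw
    rw [hwv, hwv, add_right_inj] at h1
    rw [Finset.mem_range] at hz hz'
    have h2 : ((p ^ m * z : ℕ) : ZMod (p ^ h)) = (p ^ m * z' : ℕ) := by
      push_cast; exact h1
    have hlt (z : ℕ) (hz : z < p ^ n) : p ^ m * z < p ^ h := by
      rw [hh, pow_add, mul_comm]
      exact Nat.mul_lt_mul_of_pos_right hz (pow_pos hpp.pos m)
    rw [ZMod.natCast_eq_natCast_iff', Nat.mod_eq_of_lt (hlt z hz),
      Nat.mod_eq_of_lt (hlt z' hz')] at h2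
    exact Nat.eq_of_mul_eq_mul_left (pow_pos hpp.pos m) h2
  · intro d hd
    have h1 := (Finset.mem_filter.1 hd).2
    obtain ⟨k, hk⟩ : ∃ k, k = ((d : ZMod (p ^ h)) - 1).val := ⟨_, rfl⟩
    have hk' : (k : ZMod (p ^ h)) = d - 1 := by rw [hk, ZMod.natCast_zmod_val]
    have hklt : k < p ^ h := hk ▸ ZMod.val_lt _
    rw [← hk', ← Nat.cast_pow, ← Nat.cast_mul, ZMod.natCast_eq_zero_iff, hh, pow_add] at h1
    obtain ⟨z, rfl⟩ := Nat.dvd_of_mul_dvd_mul_left (pow_pos hpp.pos n) h1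
    refine ⟨z, ?_, ?_⟩
    · rw [hh, pow_add, mul_comm] at hklt
      exact Finset.mem_range.2 (Nat.lt_of_mul_lt_mul_right hklt)
    · apply Units.ext
      rw [hwv]
      push_cast at hk'
      rw [hk']; ring
  · intro z _
    rw [hwi, hwv, ← AddChar.map_add_eq_mul]
    congr 1
    ring

theorem sum_range_mul_natCast {M : Type*} [AddCommMonoid M] (p k : ℕ) [NeZero p] (f : ZMod p → M) :
    ∑ z ∈ Finset.range (k * p), f z = k • ∑ z : ZMod p, f z := by
  induction k with
  | zero => simp
  | succ k ih =>
    rw [Nat.succ_mul, Finset.sum_range_add, ih, succ_nsmul, sum_zmod_eq_sum_range]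
    simp

theorem stdAddChar_pow_mul (p h k : ℕ) [Fact p.Prime] (hh : h = k + 1) (hdvd : p ∣ p ^ h)
    (x : ZMod (p ^ h)) :
    ZMod.stdAddChar ((p : ZMod (p ^ h)) ^ k * x) =
      ZMod.stdAddChar (ZMod.castHom hdvd (ZMod p) x) := by
  obtain ⟨j, rfl⟩ := ZMod.intCast_surjective x
  have hp0 : (p : ℂ) ≠ 0 := by exact_mod_cast (Fact.out : p.Prime).ne_zero
  have h1 := ZMod.stdAddChar_coe (N := p ^ h) (p ^ k * j)
  push_cast at h1
  rw [h1, map_intCast, ZMod.stdAddChar_coe, hh]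
  congr 1
  field_simp
  ring

theorem salie_sum_even (p h m : ℕ) [Fact p.Prime] (hp : p ≠ 2) (hm : m ≠ 0) (hh : h = m + m)
    (hdvd : p ∣ p ^ h) (a : (ZMod (p ^ h))ˣ) :
    ∑ d : (ZMod (p ^ h))ˣ, quadCharC p (ZMod.castHom hdvd (ZMod p) d) *
        ZMod.stdAddChar (a * (d + (d⁻¹ : (ZMod (p ^ h))ˣ)) : ZMod (p ^ h)) =
      (p : ℂ) ^ m * (ZMod.stdAddChar (2 * a : ZMod (p ^ h)) +
        quadCharC p (-1) * ZMod.stdAddChar (-(2 * a) : ZMod (p ^ h))) := by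
  have hp0 : (p : ZMod (p ^ h)) ^ (2 * m) = 0 := by
    rw [← Nat.cast_pow, ZMod.natCast_eq_zero_iff, hh, two_mul]
  rw [sum_units_eq_local_add_local p h m hp hm (by omega) (by omega),
    sum_local_eq_sum_range p h m m hh (by omega), sum_local_eq_sum_range p h m m hh (by omega)]
  simp only [hp0, zero_mul, AddChar.map_zero_eq_one, Finset.sum_const, Finset.card_range,
    nsmul_eq_mul, mul_one, Units.val_neg, mul_neg]
  push_cast
  ring

theorem sum_range_stdAddChar_sq (p h m : ℕ) [Fact p.Prime] (hp : p ≠ 2) (hh : h = 2 * m + 1)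
    (hdvd : p ∣ p ^ h) (a : (ZMod (p ^ h))ˣ) :
    ∑ z ∈ Finset.range (p ^ (m + 1)),
        ZMod.stdAddChar ((p : ZMod (p ^ h)) ^ (2 * m) *
          ((a : ZMod (p ^ h)) * (z : ZMod (p ^ h)) ^ 2)) =
      (p : ℂ) ^ m * (quadCharC p (ZMod.castHom hdvd (ZMod p) a) * (cP p * (Real.sqrt p : ℂ))) := by
  set b : (ZMod p)ˣ := Units.map (ZMod.castHom hdvd (ZMod p)).toMonoidHom a with hb
  have hbv : (b : ZMod p) = ZMod.castHom hdvd (ZMod p) a := rfl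
  simp_rw [stdAddChar_pow_mul p h (2 * m) hh hdvd, map_mul, map_pow, map_natCast, ← hbv]
  rw [pow_succ, sum_range_mul_natCast p (p ^ m)
    (fun z => (ZMod.stdAddChar ((b : ZMod p) * z ^ 2) : ℂ)), nsmul_eq_mul, Nat.cast_pow,
    ← gaussSum_quadCharC_mulShift p hp b, ← sum_addChar_sq p hp]
  · rfl
  · exact ZMod.isPrimitive_stdAddChar p b.ne_zero

theorem salie_sum_prime (p N : ℕ) [Fact p.Prime] [NeZero N] (hp : p ≠ 2) (hN : N = p)
    (hdvd : p ∣ N) (a : (ZMod N)ˣ) :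
    ∑ d : (ZMod N)ˣ, quadCharC p (ZMod.castHom hdvd (ZMod p) d) *
        ZMod.stdAddChar (a * (d + (d⁻¹ : (ZMod N)ˣ)) : ZMod N) =
      quadCharC p (ZMod.castHom hdvd (ZMod p) a) * (cP p * (Real.sqrt p : ℂ)) *
        (ZMod.stdAddChar (2 * a : ZMod N) + ZMod.stdAddChar (-(2 * a) : ZMod N)) := by
  subst hN
  simp only [ZMod.castHom_self, RingHom.id_apply]
  rw [← gaussSum_quadCharC_mulShift N hp a]
  refine (sum_units_quadCharC_mul_addChar N hp (AddChar.mulShift ZMod.stdAddChar a)).trans ?_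
  simp only [AddChar.mulShift_apply, mul_comm (a : ZMod N), neg_mul]

theorem salie_sum_odd (p h m : ℕ) [Fact p.Prime] (hp : p ≠ 2) (hh : h = 2 * m + 1)
    (hdvd : p ∣ p ^ h) (a : (ZMod (p ^ h))ˣ) :
    ∑ d : (ZMod (p ^ h))ˣ, quadCharC p (ZMod.castHom hdvd (ZMod p) d) *
        ZMod.stdAddChar (a * (d + (d⁻¹ : (ZMod (p ^ h))ˣ)) : ZMod (p ^ h)) =
      (p : ℂ) ^ m * (quadCharC p (ZMod.castHom hdvd (ZMod p) a) * (cP p * (Real.sqrt p : ℂ))) *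
        (ZMod.stdAddChar (2 * a : ZMod (p ^ h)) +
          ZMod.stdAddChar (-(2 * a) : ZMod (p ^ h))) := by
  rcases eq_or_ne m 0 with rfl | hm
  · rw [salie_sum_prime p (p ^ h) hp (by rw [hh, mul_zero, zero_add, pow_one]), pow_zero, one_mul]
  · rw [sum_units_eq_local_add_local p h (m + 1) hp (by omega) (by omega) (by omega),
      sum_local_eq_sum_range p h (m + 1) m (by omega) (by omega),
      sum_local_eq_sum_range p h (m + 1) m (by omega) (by omega),
      sum_range_stdAddChar_sq p h m hp hh hdvd, sum_range_stdAddChar_sq p h m hp hh hdvd,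
      Units.val_neg, map_neg (ZMod.castHom hdvd (ZMod p)),
      ← neg_one_mul (ZMod.castHom hdvd (ZMod p) a), map_mul (quadCharC p), mul_neg]
    have h1 : quadCharC p (-1) * quadCharC p (-1) = 1 := by
      rw [← map_mul, neg_one_mul, neg_neg, map_one]
    linear_combination (ZMod.stdAddChar (-(2 * a) : ZMod (p ^ h)) *
      ((p : ℂ) ^ m * (quadCharC p (ZMod.castHom hdvd (ZMod p) a) *
        (cP p * (Real.sqrt p : ℂ))))) * h1

theorem aChar_eq_stdAddChar (N : ℕ) [NeZero N] (r : ℤ) (x : ZMod N) :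
    aChar N r x = ZMod.stdAddChar ((r : ZMod N) * x) := by
  have h := ZMod.stdAddChar_coe (N := N) (r * x.val)
  push_cast at h
  rw [ZMod.natCast_zmod_val] at h
  rw [h, aChar]
  congr 1
  ring

theorem legC_eq_quadCharC {p N : ℕ} [Fact p.Prime] [NeZero N] (hdvd : p ∣ N) (x : ZMod N) :
    legC p x = quadCharC p (ZMod.castHom hdvd (ZMod p) x) := by
  rw [legC, ← quadCharC_intCast, ZMod.castHom_apply, ZMod.cast_eq_val, Int.cast_natCast]

theorem legC_unit_mul_self {p N : ℕ} [Fact p.Prime] [NeZero N] (hdvd : p ∣ N) (u : (ZMod N)ˣ) :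
    legC p (u : ZMod N) * legC p (u : ZMod N) = 1 := by
  have h : ZMod.castHom hdvd (ZMod p) u ≠ 0 := (u.isUnit.map _).ne_zero
  have h1 := congrArg (Int.castRingHom ℂ) (quadraticChar_sq_one h)
  rw [map_pow, map_one, sq] at h1
  rw [legC_eq_quadCharC hdvd]
  exact h1

/-- The substitution `d ↦ A d⁻¹` negates the Salié sum when `A` is a non-residue. -/
theorem salie_sum_eq_zero {p N : ℕ} [Fact p.Prime] [NeZero N] (hdvd : p ∣ N) (r : ℤ)
    (A : (ZMod N)ˣ) (hA : legC p (A : ZMod N) = -1) :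
    ∑ d : (ZMod N)ˣ, legC p (d : ZMod N) *
        aChar N r ((d : ZMod N) + (A : ZMod N) * ((d⁻¹ : (ZMod N)ˣ) : ZMod N)) = 0 := by
  refine self_eq_neg.1 ?_
  rw [← Finset.sum_neg_distrib, ← Equiv.sum_comp ((Equiv.inv _).trans (Equiv.mulLeft A))]
  refine Finset.sum_congr rfl fun d _ => ?_
  have hmul : legC p ((A * d⁻¹ : (ZMod N)ˣ) : ZMod N) * legC p (d : ZMod N) = -1 := by
    rw [← hA]
    simp only [legC_eq_quadCharC hdvd, ← map_mul, ← Units.val_mul, inv_mul_cancel_right]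
  have hleg : legC p ((A * d⁻¹ : (ZMod N)ˣ) : ZMod N) = -legC p (d : ZMod N) := by
    linear_combination legC p (d : ZMod N) * hmul -
      legC p ((A * d⁻¹ : (ZMod N)ˣ) : ZMod N) * legC_unit_mul_self hdvd d
  have harg : ((A * d⁻¹ : (ZMod N)ˣ) : ZMod N) + A * (((A * d⁻¹)⁻¹ : (ZMod N)ˣ) : ZMod N) =
      d + A * (d⁻¹ : (ZMod N)ˣ) := by
    rw [← Units.val_mul A (A * d⁻¹)⁻¹, _root_.mul_inv_rev, inv_inv, mul_comm d, mul_inv_cancel_left,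
      Units.val_mul, add_comm]
  simp only [Equiv.trans_apply, Equiv.inv_apply, Equiv.coe_mulLeft]
  rw [harg, hleg, neg_mul]

/-- A Salié sum with parameters `(r, u ^ 2)` reduces to one with parameters `(r * u, 1)`. -/
theorem salie_sum_sq (p h : ℕ) [Fact p.Prime] (hdvd : p ∣ p ^ h) (r : ℤ)
    (u ρ : (ZMod (p ^ h))ˣ) (hρ : (ρ : ZMod (p ^ h)) = r) :
    ∑ d : (ZMod (p ^ h))ˣ, legC p (d : ZMod (p ^ h)) *
        aChar (p ^ h) r ((d : ZMod (p ^ h)) + ((u ^ 2 : (ZMod (p ^ h))ˣ) : ZMod (p ^ h)) *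
          ((d⁻¹ : (ZMod (p ^ h))ˣ) : ZMod (p ^ h))) =
      legC p (u : ZMod (p ^ h)) *
        ∑ d : (ZMod (p ^ h))ˣ, quadCharC p (ZMod.castHom hdvd (ZMod p) d) *
          ZMod.stdAddChar ((ρ * u : (ZMod (p ^ h))ˣ) *
            (d + (d⁻¹ : (ZMod (p ^ h))ˣ)) : ZMod (p ^ h)) := by
  rw [← Equiv.sum_comp (Equiv.mulLeft u), Finset.mul_sum]
  refine Finset.sum_congr rfl fun d _ => ?_
  have hu : (u : ZMod (p ^ h)) * (u⁻¹ : (ZMod (p ^ h))ˣ) = 1 := u.mul_inv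
  simp only [Equiv.coe_mulLeft, aChar_eq_stdAddChar, legC_eq_quadCharC hdvd,
    _root_.mul_inv_rev, Units.val_mul, Units.val_pow_eq_pow_val, map_mul, hρ]
  rw [mul_assoc]
  congr 3
  linear_combination ((r : ZMod (p ^ h)) * u * (d⁻¹ : (ZMod (p ^ h))ˣ)) * hu

/-- §4, case (v): evaluation of the Salié-type sum
`K′ = Σ_{d ∈ (ℤ/p^h)^×} (d/p)·λ₁(d + A·d⁻¹)` for a unit `A`. If `(A/p) = −1` then
`K′ = 0`; if `A = u²` for a unit `u`, then `K′ = (r/p)·c_p·p^{(h−1)/2}·√p·(λ₁(2u)+λ₁(−2u))`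
when `h` is odd, and `K′ = (u/p)·p^{h/2}·(λ₁(2u)+(−1/p)·λ₁(−2u))` when `h` is even. -/
theorem appendix_salie_eval (p h : ℕ) [Fact p.Prime] (hp : Odd p) (hh : 1 ≤ h)
    (r : ℤ) (hpr : ¬ ((p : ℤ) ∣ r)) (A : (ZMod (p ^ h))ˣ) :
    (legendreSym p (((A : ZMod (p ^ h)).val : ℤ)) = -1 →
      (∑ d : (ZMod (p ^ h))ˣ, legC p (d : ZMod (p ^ h)) *
          aChar (p ^ h) r ((d : ZMod (p ^ h)) +
            (A : ZMod (p ^ h)) * ((d⁻¹ : (ZMod (p ^ h))ˣ) : ZMod (p ^ h))))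
        = 0) ∧
    (∀ u : (ZMod (p ^ h))ˣ, A = u ^ 2 →
      (Odd h →
        (∑ d : (ZMod (p ^ h))ˣ, legC p (d : ZMod (p ^ h)) *
            aChar (p ^ h) r ((d : ZMod (p ^ h)) +
              (A : ZMod (p ^ h)) * ((d⁻¹ : (ZMod (p ^ h))ˣ) : ZMod (p ^ h))))
          = (legendreSym p r : ℂ) * cP p * (p : ℂ) ^ ((h - 1) / 2) * (Real.sqrt p : ℂ) *
              (aChar (p ^ h) r (2 * (u : ZMod (p ^ h))) +
                aChar (p ^ h) r (-(2 * (u : ZMod (p ^ h)))))) ∧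
      (Even h →
        (∑ d : (ZMod (p ^ h))ˣ, legC p (d : ZMod (p ^ h)) *
            aChar (p ^ h) r ((d : ZMod (p ^ h)) +
              (A : ZMod (p ^ h)) * ((d⁻¹ : (ZMod (p ^ h))ˣ) : ZMod (p ^ h))))
          = legC p (u : ZMod (p ^ h)) * (p : ℂ) ^ (h / 2) *
              (aChar (p ^ h) r (2 * (u : ZMod (p ^ h))) +
                (legendreSym p (-1) : ℂ) * aChar (p ^ h) r (-(2 * (u : ZMod (p ^ h))))))) := by
  have hpp := (Fact.out : p.Prime)
  have hp2 : p ≠ 2 := by rintro rfl; exact absurd hp (by decide)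
  have hdvd : p ∣ p ^ h := dvd_pow_self p (by omega)
  refine ⟨fun hA => ?_, ?_⟩
  · exact salie_sum_eq_zero hdvd r A (by rw [legC, hA]; simp)
  · rintro u rfl
    have hrZ : (r : ZMod p) ≠ 0 := by rwa [Ne, ZMod.intCast_zmod_eq_zero_iff_dvd]
    obtain ⟨ρ, hρ⟩ : IsUnit (r : ZMod (p ^ h)) :=
      zmod_isUnit_of_castHom_ne_zero hdvd (by rwa [map_intCast])
    have e1 : aChar (p ^ h) r (2 * (u : ZMod (p ^ h))) =
        ZMod.stdAddChar (2 * ((ρ * u : (ZMod (p ^ h))ˣ) : ZMod (p ^ h))) := by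
      rw [aChar_eq_stdAddChar, Units.val_mul, hρ]; congr 1; ring
    have e2 : aChar (p ^ h) r (-(2 * (u : ZMod (p ^ h)))) =
        ZMod.stdAddChar (-(2 * ((ρ * u : (ZMod (p ^ h))ˣ) : ZMod (p ^ h)))) := by
      rw [aChar_eq_stdAddChar, Units.val_mul, hρ]; congr 1; ring
    rw [salie_sum_sq p h hdvd r u ρ hρ, e1, e2]
    refine ⟨?_, ?_⟩
    · rintro ⟨m, hm⟩
      rw [salie_sum_odd p h m hp2 hm hdvd, show (h - 1) / 2 = m by omega, Units.val_mul, map_mul,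
        map_mul, hρ, map_intCast, quadCharC_intCast, ← legC_eq_quadCharC hdvd]
      linear_combination ((p : ℂ) ^ m * legendreSym p r * (cP p * (Real.sqrt p : ℂ)) *
        (ZMod.stdAddChar (2 * ((r : ZMod (p ^ h)) * (u : ZMod (p ^ h)))) +
          ZMod.stdAddChar (-(2 * ((r : ZMod (p ^ h)) * (u : ZMod (p ^ h))))))) *
        legC_unit_mul_self hdvd u
    · rintro ⟨m, hm⟩
      rw [salie_sum_even p h m hp2 (by omega) hm hdvd, show h / 2 = m by omega,
        quadCharC_neg_one, mul_assoc]
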